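/- arXiv:1712.07723 — 2 statements merged into one kernel-verified Lean document; each statement's English description precedes it below -/
import Mathlib

section
/- Let p be a prime with p ≡ 3 (mod 4) and let e ≥ 1 be an odd integer; set q = p^e. If n_1, n_2 ≥ 1 are integers with n_1 ≡ n_2 (mod p^{2e} − 1), then f_{n_1}(x) = f_{n_2}(x) for all x ∈ 𝔽_q. -/
open Polynomial

/-- The Fibonacci polynomials over ℤ: `f 0 = 0`, `f 1 = 1`,
`f (n+2) = X * f (n+1) + f n`. -/
noncomputable def fibPoly : ℕ → Polynomial ℤ
  | 0 => 0
  | 1 => 1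
  | (n + 2) => X * fibPoly (n + 1) + fibPoly n

theorem map_aeval_int {R S : Type*} [CommRing R] [CommRing S] (φ : R →+* S) (x : R)
    (f : ℤ[X]) : φ (aeval x f) = aeval (φ x) f :=
  (aeval_algHom_apply φ.toIntAlgHom x f).symm

theorem sub_mul_aeval_fibPoly {K : Type*} [CommRing K] {x a b : K} (hs : a + b = x)
    (hm : a * b = -1) (n : ℕ) : (a - b) * aeval x (fibPoly n) = a ^ n - b ^ n := by
  induction n using Nat.twoStepInduction with
  | zero => simp [fibPoly]
  | one => simp [fibPoly]
  | more n h0 h1 =>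
    simp only [fibPoly, map_add, map_mul, aeval_X]
    have ha : a ^ 2 = x * a + 1 := by linear_combination a * hs - hm
    have hb : b ^ 2 = x * b + 1 := by linear_combination b * hs - hm
    linear_combination x * h1 + h0 - a ^ n * ha + b ^ n * hb

theorem sq_add_four_ne_zero {F : Type*} [Field F] [Fintype F]
    (hF : Fintype.card F % 4 = 3) (x : F) : x ^ 2 + 4 ≠ 0 := by
  intro h
  have h2 : (2 : F) ≠ 0 := by
    apply Ring.two_ne_zero
    intro h2
    have := (FiniteField.even_card_iff_char_two (F := F)).1 h2
    omega
  refine FiniteField.isSquare_neg_one_iff.1 ⟨x / 2, ?_⟩ hF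
  field_simp
  linear_combination -h

theorem pow_card_pow_two_eq_self {F K : Type*} [Field F] [Fintype F] [Field K] [Algebra F K]
    {x : F} {a b : K} (hs : a + b = algebraMap F K x) (hm : a * b = -1) :
    a ^ Fintype.card F ^ 2 = a := by
  obtain ⟨p, hchar⟩ := CharP.exists F
  obtain ⟨n, hp, hq⟩ := FiniteField.card F p
  have : Fact p.Prime := ⟨hp⟩
  have : CharP K p := charP_of_injective_algebraMap (algebraMap F K).injective p
  have hadd : a ^ Fintype.card F + b ^ Fintype.card F = a + b := by
    rw [hq, ← add_pow_char_pow, hs, ← map_pow, ← hq, FiniteField.pow_card]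
  have hmul : a ^ Fintype.card F * b ^ Fintype.card F = a * b := by
    rw [← mul_pow, hm]
    have := congrArg (algebraMap F K) (FiniteField.pow_card (-1 : F))
    simpa using this
  have hroot : (a ^ Fintype.card F - a) * (a ^ Fintype.card F - b) = 0 := by
    linear_combination a ^ Fintype.card F * hadd - hmul
  rw [sq, pow_mul]
  rcases mul_eq_zero.1 hroot with h | h
  · rw [sub_eq_zero.1 h, sub_eq_zero.1 h]
  · rw [sub_eq_zero.1 h]
    linear_combination hadd - h

theorem pow_eq_pow_of_modEq_card_sq_sub_one {F K : Type*} [Field F] [Fintype F] [Field K]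
    [Algebra F K] {x : F} {a b : K} (hs : a + b = algebraMap F K x) (hm : a * b = -1)
    {m n : ℕ} (h : m ≡ n [MOD Fintype.card F ^ 2 - 1]) : a ^ m = a ^ n := by
  have ha : a ≠ 0 := by
    rintro rfl
    simp at hm
  refine pow_eq_pow_of_modEq h (mul_right_cancel₀ ha ?_)
  rw [← pow_succ, Nat.sub_add_cancel (Nat.one_le_pow _ _ Fintype.card_pos),
    pow_card_pow_two_eq_self hs hm, one_mul]

theorem exists_add_eq_mul_eq_neg_one {K : Type*} [Field K] [IsAlgClosed K] (x : K) :
    ∃ a b : K, a + b = x ∧ a * b = -1 := by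
  have hdeg : (C (1 : K) * X ^ 2 + C (-x) * X + C (-1)).degree = 2 :=
    degree_quadratic one_ne_zero
  obtain ⟨a, ha⟩ := IsAlgClosed.exists_root (C (1 : K) * X ^ 2 + C (-x) * X + C (-1))
    (by rw [hdeg]; decide)
  simp only [IsRoot.def, eval_add, eval_mul, eval_C, eval_pow, eval_X] at ha
  exact ⟨a, x - a, by ring, by linear_combination -ha⟩

theorem fibPoly_period_case2 (p e : ℕ) (hp : p.Prime) (hp4 : p % 4 = 3)
    (he : 1 ≤ e) (hodd : Odd e)
    (F : Type*) [Field F] [Fintype F] (hcard : Fintype.card F = p ^ e)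
    (n₁ n₂ : ℕ) (hn₁ : 1 ≤ n₁) (hn₂ : 1 ≤ n₂)
    (hcong : n₁ ≡ n₂ [MOD p ^ (2 * e) - 1]) (x : F) :
    Polynomial.aeval x (fibPoly n₁) = Polynomial.aeval x (fibPoly n₂) := by
  have hF : Fintype.card F % 4 = 3 := by
    obtain ⟨k, rfl⟩ := hodd
    rw [hcard, pow_succ, pow_mul, Nat.mul_mod, Nat.pow_mod, Nat.pow_mod p, hp4]
    norm_num
  rw [mul_comm 2 e, pow_mul, ← hcard] at hcong
  obtain ⟨a, b, hs, hm⟩ := exists_add_eq_mul_eq_neg_one (algebraMap F (AlgebraicClosure F) x)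
  have hab : a - b ≠ 0 := by
    intro h
    apply sq_add_four_ne_zero hF x
    apply (algebraMap F (AlgebraicClosure F)).injective
    simp only [map_add, map_pow, ← hs, map_ofNat, map_zero]
    linear_combination (a - b) * h + 4 * hm
  apply (algebraMap F (AlgebraicClosure F)).injective
  rw [map_aeval_int, map_aeval_int]
  apply mul_left_cancel₀ hab
  rw [sub_mul_aeval_fibPoly hs hm, sub_mul_aeval_fibPoly hs hm,
    pow_eq_pow_of_modEq_card_sq_sub_one hs hm hcong,
    pow_eq_pow_of_modEq_card_sq_sub_one ((add_comm b a).trans hs) ((mul_comm b a).trans hm) hcong]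
end

section
/- Let p be an odd prime and e ≥ 1 an integer with either p ≡ 1 (mod 4) or e even; set q = p^e and s = p(q² − 1)/2. For j ≥ 1 let d_j = Σ_{x ∈ 𝔽_q} f_j(x) ∈ 𝔽_q. For 1 ≤ k ≤ s − q + 2 define b_k ∈ 𝔽_q by b_k = 1 if k = 1 + t(q − 1) for some integer t with 0 ≤ t ≤ p(q+1)/2 − 1, and b_k = 0 otherwise. Then: (i) d_j = 0 for 1 ≤ j ≤ q − 1; (ii) d_j = −b_{j−(q−1)} for j = q and j = q + 1; (iii) d_j = −b_{j−(q−1)} − d_{j−(q+1)} for q + 2 ≤ j ≤ s − (q + 1); (iv) d_{s−q} = −b_{s−q+2}; (v) d_j = 0 for s − (q − 1) ≤ j ≤ s. -/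
open Polynomial

theorem PowerSeries.mk_aeval_fibPoly_mul {F : Type*} [Field F] (x : F) :
    PowerSeries.mk (fun j => Polynomial.aeval x (fibPoly j)) *
      (1 - X ^ 2 - C x * X) = (X : PowerSeries F) := by
  set G : PowerSeries F := PowerSeries.mk (fun j => Polynomial.aeval x (fibPoly j)) with hG
  have expand : G * (1 - X ^ 2 - C x * X) = G - G * X ^ 2 - C x * (G * X ^ 1) := by ring
  rw [expand]
  ext n
  simp only [map_sub, coeff_C_mul, coeff_mul_X_pow', hG, coeff_mk, coeff_X]
  match n with
  | 0 => simp [fibPoly]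
  | 1 => simp [fibPoly]
  | n + 2 => simp [fibPoly]

/-- The sum of `(a - x b) ^ (q - 1)` over all `x` in a finite field with `q` elements. -/
theorem FiniteField.sum_sub_algebraMap_mul_pow {F A : Type*} [Field F] [Fintype F] [CommRing A]
    [Algebra F A] (hodd : Odd (Fintype.card F)) (a b : A) :
    ∑ x : F, (a - algebraMap F A x * b) ^ (Fintype.card F - 1) =
      -b ^ (Fintype.card F - 1) := by
  classical
  set n := Fintype.card F - 1 with hn
  have hn_even : Even n := hodd.tsub_odd odd_one
  have hcard : 1 < Fintype.card F := Fintype.one_lt_card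
  have hsum : ∑ x : F, x ^ n = -1 := by
    have h := FiniteField.sum_pow_units F n
    rw [if_pos hn.symm.dvd] at h
    have h0 : ∑ x : F, x ^ n = ∑ x : Fˣ, (x : F) ^ n := by
      have hn0 : n ≠ 0 := by omega
      rw [← Fintype.sum_subtype_add_sum_subtype (fun x : F => x ≠ 0)]
      rw [Fintype.sum_equiv unitsEquivNeZero (fun x : Fˣ => (x : F) ^ n)
        (fun x : {x : F // x ≠ 0} => (x : F) ^ n) (fun x => by simp)]
      simp only [add_eq_left]
      refine Finset.sum_eq_zero fun x _ => ?_
      rw [not_not.mp x.2, zero_pow hn0]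
    rw [h0]
    exact_mod_cast h
  have hexpand : ∀ x : F, (a - algebraMap F A x * b) ^ n =
      ∑ i ∈ Finset.range (n + 1),
        algebraMap F A (x ^ i) * ((-b) ^ i * a ^ (n - i) * (n.choose i : A)) := by
    intro x
    rw [sub_eq_neg_add, add_pow]
    refine Finset.sum_congr rfl fun i _ => ?_
    rw [← mul_neg, mul_pow, map_pow]
    ring
  simp_rw [hexpand]
  rw [Finset.sum_comm]
  simp_rw [← Finset.sum_mul, ← map_sum]
  rw [Finset.sum_range_succ, Finset.sum_eq_zero, hsum]
  · simp [hn_even.neg_pow]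
  · intro i hi
    rw [FiniteField.sum_pow_lt_card_sub_one (K := F) i (by simpa [hn] using hi)]
    simp

theorem PowerSeries.mk_sum_aeval_fibPoly_mul {F : Type*} [Field F] [Fintype F]
    (hodd : Odd (Fintype.card F)) :
    PowerSeries.mk (fun j => ∑ x : F, Polynomial.aeval x (fibPoly j)) *
      ((1 - X ^ (Fintype.card F - 1)) * (1 + X ^ (Fintype.card F + 1))) =
        -(X : PowerSeries F) ^ Fintype.card F := by
  obtain ⟨p, hchar⟩ := CharP.exists F
  obtain ⟨e, hp, hq⟩ := FiniteField.card F p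
  have : Fact p.Prime := ⟨hp⟩
  have : CharP (PowerSeries F) p := charP_of_injective_ringHom
    (f := (PowerSeries.C : F →+* PowerSeries F)) PowerSeries.C_injective p
  have hfrob : ∀ a b : PowerSeries F,
      (a - b) ^ Fintype.card F = a ^ Fintype.card F - b ^ Fintype.card F := by
    intro a b
    rw [hq]
    exact sub_pow_char_pow a b e
  have hpow : ∀ x : F, x ^ Fintype.card F = x := FiniteField.pow_card
  have hsum := FiniteField.sum_sub_algebraMap_mul_pow hodd (1 - X ^ 2 : PowerSeries F) X
  have hzero : ((Fintype.card F : ℕ) : PowerSeries F) = 0 := by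
    rw [hq, Nat.cast_pow, CharP.cast_eq_zero, zero_pow e.ne_zero]
  have hmk : PowerSeries.mk (fun j => ∑ x : F, Polynomial.aeval x (fibPoly j)) =
      ∑ x : F, PowerSeries.mk (fun j => Polynomial.aeval x (fibPoly j)) := by
    ext n
    simp [map_sum]
  obtain ⟨n, hn⟩ : ∃ n, Fintype.card F = n + 1 := ⟨_, (Nat.succ_pred Fintype.card_ne_zero).symm⟩
  have hcard : (Finset.univ : Finset F).card = n + 1 := by rw [Finset.card_univ, hn]
  rw [hn] at hfrob hpow hsum hzero ⊢
  simp only [add_tsub_cancel_right] at hsum ⊢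
  have hterm : ∀ x : F, PowerSeries.mk (fun j => Polynomial.aeval x (fibPoly j)) *
      ((1 - X ^ n) * (1 + X ^ (n + 1 + 1))) =
        X * ((1 - X ^ 2 - algebraMap F (PowerSeries F) x * X) ^ n - X ^ n) := by
    intro x
    have halg : algebraMap F (PowerSeries F) x = C x := rfl
    rw [halg]
    have hfib := mk_aeval_fibPoly_mul x
    have h2 : (1 - X ^ 2 - C x * X : PowerSeries F) ^ (n + 1) =
        1 - (X ^ 2) ^ (n + 1) - C x * X ^ (n + 1) := by
      rw [hfrob, hfrob, one_pow, mul_pow, ← map_pow, hpow]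
    have hfac : ((1 - X ^ n) * (1 + X ^ (n + 1 + 1)) : PowerSeries F) =
        (1 - X ^ 2 - C x * X) * ((1 - X ^ 2 - C x * X) ^ n - X ^ n) := by
      rw [mul_sub, ← pow_succ', h2]
      ring
    rw [hfac, ← mul_assoc, hfib]
  rw [hmk, Finset.sum_mul, Finset.sum_congr rfl fun x _ => hterm x, ← Finset.mul_sum,
    Finset.sum_sub_distrib, hsum, Finset.sum_const, hcard, nsmul_eq_mul, hzero]
  ring

theorem PowerSeries.coeff_of_mul_one_sub_X_pow {R : Type*} [CommRing R] {n : ℕ} (hn : 0 < n)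
    {E : PowerSeries R} (hE : E * (1 - X ^ n) = -X ^ (n + 1))
    [DecidablePred fun j => ∃ t, j = n + 1 + t * n] (j : ℕ) :
    coeff j E = if ∃ t, j = n + 1 + t * n then -1 else 0 := by
  induction j using Nat.strong_induction_on with
  | _ j ih =>
  have h := congrArg (coeff j) hE
  rw [mul_sub, mul_one, map_sub, map_neg, coeff_X_pow, coeff_mul_X_pow'] at h
  by_cases hj : n ≤ j
  · rw [if_pos hj, ih (j - n) (by omega)] at h
    rw [sub_eq_iff_eq_add] at h
    rw [h]
    by_cases hj1 : j = n + 1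
    · rw [if_pos hj1, if_neg, if_pos ⟨0, by omega⟩, add_zero]
      rintro ⟨t, ht⟩
      omega
    · rw [if_neg hj1, neg_zero, zero_add]
      refine if_congr ⟨?_, ?_⟩ rfl rfl
      · rintro ⟨t, ht⟩
        exact ⟨t + 1, by rw [add_mul]; omega⟩
      · rintro ⟨_ | t, ht⟩
        · omega
        · exact ⟨t, by rw [add_mul] at ht; omega⟩
  · rw [if_neg hj, if_neg (by omega), sub_zero, neg_zero] at h
    rw [h, if_neg]
    rintro ⟨t, ht⟩
    omega

theorem fibPoly_sum_add_sum {F : Type*} [Field F] [Fintype F] (hodd : Odd (Fintype.card F))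
    [DecidablePred fun j => ∃ t, j = Fintype.card F + t * (Fintype.card F - 1)] (j : ℕ) :
    (∑ x : F, Polynomial.aeval x (fibPoly j)) +
      (if Fintype.card F + 1 ≤ j then
        ∑ x : F, Polynomial.aeval x (fibPoly (j - (Fintype.card F + 1))) else 0) =
      if ∃ t, j = Fintype.card F + t * (Fintype.card F - 1) then -1 else 0 := by
  classical
  have h := PowerSeries.mk_sum_aeval_fibPoly_mul hodd
  have hcard : 1 < Fintype.card F := Fintype.one_lt_card
  have hsucc : Fintype.card F - 1 + 1 = Fintype.card F := by omega
  rw [mul_comm (1 - _), ← mul_assoc] at h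
  have := PowerSeries.coeff_of_mul_one_sub_X_pow (n := Fintype.card F - 1) (by omega)
    (by rw [h, hsucc]) j
  simpa only [mul_add, mul_one, map_add, PowerSeries.coeff_mul_X_pow',
    PowerSeries.coeff_mk, hsucc] using this

/-- If the rational function `-z ^ q / Q(z)` with `Q` a divisor of `1 - z ^ s` has power series
expansion `D`, the last coefficients of `D` before `s` can be read off from the degree of `Q`. -/
theorem Polynomial.coeff_of_mul_coe_eq_neg_X_pow {F : Type*} [Field F] {q s : ℕ} {Q : F[X]}
    (hqs : 2 * q ≤ s) (hq : 0 < q) (hdeg : Q.natDegree = 2 * q) (hlead : Q.leadingCoeff = -1)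
    (hdvd : Q ∣ 1 - X ^ s) {D : PowerSeries F}
    (hD : D * (Q : PowerSeries F) = -PowerSeries.X ^ q) :
    PowerSeries.coeff (s - q) D = -1 ∧ ∀ j, s - q < j → j ≤ s → PowerSeries.coeff j D = 0 := by
  obtain ⟨P, hP⟩ := hdvd
  have hs : 0 < s := by omega
  have hflip : (1 - X ^ s : F[X]) = -(X ^ s - C 1) := by simp
  have hdeg1 : (1 - X ^ s : F[X]).natDegree = s := by
    rw [hflip, natDegree_neg, natDegree_X_pow_sub_C]
  have hlead1 : (1 - X ^ s : F[X]).leadingCoeff = -1 := by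
    rw [hflip, leadingCoeff_neg, leadingCoeff_X_pow_sub_C hs]
  have hQ0 : Q ≠ 0 := by
    rintro rfl
    simp at hlead
  have hPlead : P.leadingCoeff = 1 := by
    rw [hP, leadingCoeff_mul, hlead] at hlead1
    simpa using hlead1
  have hP0 : P ≠ 0 := by
    rintro rfl
    simp at hPlead
  have hPdeg : P.natDegree = s - 2 * q := by
    rw [hP, natDegree_mul hQ0 hP0, hdeg] at hdeg1
    omega
  have hcoe : (Q : PowerSeries F) * (P : PowerSeries F) = 1 - PowerSeries.X ^ s := by
    rw [← Polynomial.coe_mul, ← hP]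
    simp
  have hDs : D - D * PowerSeries.X ^ s = -((X ^ q * P : F[X]) : PowerSeries F) := by
    calc D - D * PowerSeries.X ^ s = D * (Q : PowerSeries F) * (P : PowerSeries F) := by
          rw [mul_assoc, hcoe]; ring
      _ = _ := by rw [hD]; simp
  have hconst : PowerSeries.coeff 0 D = 0 := by
    have h := congrArg (PowerSeries.coeff 0) hDs
    simpa [hs.ne', hq.ne', PowerSeries.coeff_zero_eq_constantCoeff] using h
  have hcoeff : ∀ j ≤ s, PowerSeries.coeff j D = -(X ^ q * P).coeff j := by
    intro j hj
    have h := congrArg (PowerSeries.coeff j) hDs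
    rw [map_sub, PowerSeries.coeff_mul_X_pow', map_neg, Polynomial.coeff_coe] at h
    rw [← h]
    split_ifs with hjs
    · rw [show j - s = 0 by omega, hconst, sub_zero]
    · rw [sub_zero]
  have hNdeg : (X ^ q * P).natDegree = s - q := by
    rw [natDegree_X_pow_mul _ hP0, hPdeg]
    omega
  refine ⟨?_, fun j hj hjs => ?_⟩
  · rw [hcoeff _ (by omega), ← hNdeg, coeff_natDegree, leadingCoeff_mul, leadingCoeff_X_pow,
      hPlead, one_mul]
  · rw [hcoeff _ hjs, coeff_eq_zero_of_natDegree_lt (by omega), neg_zero]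

theorem one_sub_X_pow_mul_one_add_X_pow_dvd {F : Type*} [Field F] {p : ℕ} [Fact p.Prime]
    [CharP F p] (u : ℕ) :
    (1 - X ^ (4 * u)) * (1 + X ^ (4 * u + 2)) ∣
      (1 - X ^ (p * (2 * u + 1) * (4 * u)) : F[X]) := by
  have hp : 2 ≤ p := (Fact.out : p.Prime).two_le
  set m := (2 * u + 1) * (4 * u) with hm
  have h1 : (1 - X ^ (4 * u) : F[X]) ∣ 1 - X ^ m := by
    have := sub_dvd_pow_sub_pow (1 : F[X]) (X ^ (4 * u)) (2 * u + 1)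
    rwa [one_pow, ← pow_mul, mul_comm (4 * u)] at this
  have h2 : (1 + X ^ (4 * u + 2) : F[X]) ∣ 1 - X ^ m := by
    have := sub_dvd_pow_sub_pow (1 : F[X]) (-X ^ (4 * u + 2)) (2 * u)
    rw [one_pow, (even_two_mul u).neg_pow, ← pow_mul, sub_neg_eq_add] at this
    rwa [hm, show (2 * u + 1) * (4 * u) = (4 * u + 2) * (2 * u) by ring]
  have h3 : (1 - X ^ (p * (2 * u + 1) * (4 * u)) : F[X]) = (1 - X ^ m) ^ p := by
    rw [sub_pow_char, one_pow, ← pow_mul]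
    congr 2
    rw [hm]
    ring
  rw [h3]
  refine (mul_dvd_mul h1 h2).trans ?_
  rw [← sq]
  exact pow_dvd_pow _ hp

theorem Nat.pow_mod_four_eq_one {p e : ℕ} (hodd : Odd p) (hcase : p % 4 = 1 ∨ Even e) :
    p ^ e % 4 = 1 := by
  rcases hcase with h | ⟨k, rfl⟩
  · simp [Nat.pow_mod, h]
  · obtain ⟨c, hc⟩ := hodd.pow (n := k)
    rw [pow_add, hc]
    ring_nf
    omega

/-- First-moment recursion for Fibonacci polynomials over `F = 𝔽_q`, `q = p^e`,
with `p ≡ 1 (mod 4)` (any `e`) or `e` even, where `s = p(q² - 1)/2`. -/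
theorem fibPoly_first_moment_case1 (p e : ℕ) (hp : p.Prime) (hodd : Odd p)
    (he : 1 ≤ e) (hcase : p % 4 = 1 ∨ Even e)
    (q s : ℕ) (hq : q = p ^ e) (hs : s = p * (q ^ 2 - 1) / 2)
    (F : Type*) [Field F] [Fintype F] (hcard : Fintype.card F = q)
    (d : ℕ → F) (hd : ∀ j, d j = ∑ x : F, Polynomial.aeval x (fibPoly j))
    (b : ℕ → F)
    (hb1 : ∀ k, 1 ≤ k → k ≤ s - q + 2 →
      (∃ t, t ≤ p * (q + 1) / 2 - 1 ∧ k = 1 + t * (q - 1)) → b k = 1)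
    (hb0 : ∀ k, 1 ≤ k → k ≤ s - q + 2 →
      (¬ ∃ t, t ≤ p * (q + 1) / 2 - 1 ∧ k = 1 + t * (q - 1)) → b k = 0) :
    (∀ j, 1 ≤ j → j ≤ q - 1 → d j = 0) ∧
    (∀ j, q ≤ j → j ≤ q + 1 → d j = -b (j - (q - 1))) ∧
    (∀ j, q + 2 ≤ j → j ≤ s - (q + 1) → d j = -b (j - (q - 1)) - d (j - (q + 1))) ∧
    (d (s - q) = -b (s - q + 2)) ∧
    (∀ j, s - (q - 1) ≤ j → j ≤ s → d j = 0) := by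
  classical
  have : Fact p.Prime := ⟨hp⟩
  obtain ⟨u, hu⟩ : ∃ u, q = 4 * u + 1 := by
    have := Nat.pow_mod_four_eq_one hodd hcase
    exact ⟨q / 4, by omega⟩
  have hp3 : 3 ≤ p := by
    obtain ⟨c, rfl⟩ := hodd
    have := hp.two_le
    omega
  have hq1 : 1 < q := hcard ▸ Fintype.one_lt_card
  have hu1 : 1 ≤ u := by omega
  have hqodd : Odd (Fintype.card F) := by rw [hcard, hu]; exact ⟨2 * u, by ring⟩
  have hchar : CharP F p := by
    rw [← hcard] at hq
    exact charP_of_card_eq_prime_pow hq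
  have hs' : s = p * (2 * u + 1) * (4 * u) := by
    have : p * (q ^ 2 - 1) = 2 * (p * (2 * u + 1) * (4 * u)) := by
      rw [show q ^ 2 - 1 = 2 * ((2 * u + 1) * (4 * u)) by
        rw [hu, show (4 * u + 1) ^ 2 = 2 * ((2 * u + 1) * (4 * u)) + 1 by ring]; omega]
      ring
    omega
  have hr : p * (q + 1) / 2 = p * (2 * u + 1) := by
    rw [hu, show p * (4 * u + 1 + 1) = 2 * (p * (2 * u + 1)) by ring]
    omega
  have hr9 : 9 ≤ p * (2 * u + 1) := by nlinarith
  obtain ⟨r, hrr⟩ : ∃ r, p * (2 * u + 1) = r + 1 := ⟨p * (2 * u + 1) - 1, by omega⟩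
  rw [hrr] at hr hs'
  have hsr : s = r * (4 * u) + 4 * u := by rw [hs']; ring
  have hs3 : 8 * (4 * u) + 4 * u ≤ s := by
    rw [hsr]
    have : 8 * (4 * u) ≤ r * (4 * u) := Nat.mul_le_mul_right _ (by omega)
    omega
  have hq4 : q - 1 = 4 * u := by omega
  have hb : ∀ j, q ≤ j → j ≤ s + 1 →
      -b (j - (q - 1)) = if ∃ t, j = q + t * (q - 1) then -1 else 0 := by
    intro j hj hjs
    split_ifs with h
    · obtain ⟨t, ht⟩ := h
      rw [hb1 _ (by omega) (by omega)]
      refine ⟨t, ?_, by omega⟩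
      rw [hr, Nat.add_sub_cancel]
      rw [hq4] at ht
      exact Nat.le_of_mul_le_mul_right (c := 4 * u) (by omega) (by omega)
    · rw [hb0 _ (by omega) (by omega), neg_zero]
      rintro ⟨t, -, ht⟩
      exact h ⟨t, by omega⟩
  have hrec : ∀ j, d j + (if q + 1 ≤ j then d (j - (q + 1)) else 0) =
      if ∃ t, j = q + t * (q - 1) then -1 else 0 := by
    intro j
    have h := fibPoly_sum_add_sum hqodd j
    simpa only [hcard, ← hd] using h
  have hd0 : d 0 = 0 := by simp [hd, fibPoly]
  have hD : PowerSeries.mk d * (((1 - X ^ (4 * u)) * (1 + X ^ (4 * u + 2)) : F[X]) : PowerSeries F)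
      = -PowerSeries.X ^ q := by
    have h := PowerSeries.mk_sum_aeval_fibPoly_mul hqodd
    rw [hcard, ← funext hd, hq4, show q + 1 = 4 * u + 2 by omega] at h
    simpa using h
  have hflip : (1 - X ^ (4 * u) : F[X]) = -(X ^ (4 * u) - C 1) := by simp
  have hplus : (1 + X ^ (4 * u + 2) : F[X]) = X ^ (4 * u + 2) + C 1 := by simp [add_comm]
  have hlast := Polynomial.coeff_of_mul_coe_eq_neg_X_pow (s := s) (by omega) (by omega)
    (by
      rw [hflip, hplus, neg_mul, natDegree_neg,
        (monic_X_pow_sub_C (1 : F) (by omega)).natDegree_mul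
          (monic_X_pow_add_C (1 : F) (by omega)),
        natDegree_X_pow_sub_C, natDegree_X_pow_add_C]
      omega)
    (by
      rw [hflip, hplus, neg_mul, leadingCoeff_neg,
        ((monic_X_pow_sub_C (1 : F) (by omega)).mul
          (monic_X_pow_add_C (1 : F) (by omega))).leadingCoeff])
    (by
      rw [hs', ← hrr]
      exact one_sub_X_pow_mul_one_add_X_pow_dvd (p := p) u)
    hD
  simp only [PowerSeries.coeff_mk] at hlast
  refine ⟨fun j hj hjq => ?_, fun j hj hjq => ?_, fun j hj hjs => ?_, ?_, fun j hj hjs => ?_⟩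
  · have h := hrec j
    rwa [if_neg (by omega), if_neg (by rintro ⟨t, ht⟩; omega), add_zero] at h
  · rw [hb j hj (by omega), ← hrec j]
    split_ifs with h
    · rw [show j - (q + 1) = 0 by omega, hd0, add_zero]
    · rw [add_zero]
  · rw [hb j (by omega) (by omega), ← hrec j, if_pos (by omega), add_sub_cancel_right]
  · rw [hlast.1, show s - q + 2 = s + 1 - (q - 1) by omega, hb (s + 1) (by omega) le_rfl, if_pos]
    exact ⟨r, by rw [hq4]; omega⟩
  · exact hlast.2 j (by omega) hjs
end
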